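/- arXiv:2407.06353 — 2 statements merged into one kernel-verified Lean document; each statement's English description precedes it below -/
import Mathlib

section
/- Let A be a commutative Artinian ring, G a finite group, and R = A[G] the group ring of G over A. Then every Wakamatsu tilting right R-module T of finite projective dimension is projective; in particular, the Wakamatsu tilting conjecture holds for R. -/
/-!
Common definitions for formalizing the Wakamatsu tilting conjecture paper.
All rings are associative with identity; right `R`-modules are treated as
left `Rᵐᵒᵖ`-modules.
-/

open CategoryTheory

universe u

/-- Vanishing of `Ext^n_S(X, Y)` for left `S`-modules. -/
abbrev ExtVanish (S : Type u) [Ring S] (n : ℕ) (X Y : ModuleCat.{u} S) : Prop :=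
  Subsingleton (((Ext ℤ (ModuleCat.{u} S) n).obj (Opposite.op X)).obj Y)

/-- `N ∈ add_S T`: `N` is a direct summand of a finite direct sum of copies of `T`. -/
def MemAdd (S : Type u) [Ring S] (T N : ModuleCat.{u} S) : Prop :=
  ∃ (k : ℕ) (M : ModuleCat.{u} S), Nonempty ((↥N × ↥M) ≃ₗ[S] (Fin k → ↥T))

/-- `N ∈ gen*_S(T)`: there is an exact sequence `⋯ → X_1 → X_0 → N → 0` with all
`X_i ∈ add_S T` and `Ext^1_S(T, Ker f_i) = 0` for all `i ≥ 0`. -/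
def MemGenStar (S : Type u) [Ring S] (T N : ModuleCat.{u} S) : Prop :=
  ∃ (X : ℕ → ModuleCat.{u} S) (f : ∀ i, ↥(X (i + 1)) →ₗ[S] ↥(X i)) (f0 : ↥(X 0) →ₗ[S] ↥N),
    (∀ i, MemAdd S T (X i)) ∧
    Function.Surjective f0 ∧
    Function.Exact (f 0) f0 ∧
    (∀ i, Function.Exact (f (i + 1)) (f i)) ∧
    ExtVanish S 1 T (ModuleCat.of S (LinearMap.ker f0)) ∧
    (∀ i, ExtVanish S 1 T (ModuleCat.of S (LinearMap.ker (f i))))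

/-- The projective dimension of the left `S`-module `M` is at most `n`: there is a projective
resolution `0 → P_n → ⋯ → P_0 → M → 0`. -/
def PdLE (S : Type u) [Ring S] (M : ModuleCat.{u} S) (n : ℕ) : Prop :=
  ∃ (P : ℕ → ModuleCat.{u} S) (d : ∀ i, ↥(P (i + 1)) →ₗ[S] ↥(P i)) (ε : ↥(P 0) →ₗ[S] ↥M),
    (∀ i, Module.Projective S ↥(P i)) ∧
    Function.Surjective ε ∧
    Function.Exact (d 0) ε ∧
    (∀ i, Function.Exact (d (i + 1)) (d i)) ∧
    (∀ i, n < i → Subsingleton ↥(P i))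

/-- The projective dimension of `M` equals `n`. -/
def PdEq (S : Type u) [Ring S] (M : ModuleCat.{u} S) (n : ℕ) : Prop :=
  PdLE S M n ∧ ∀ m, PdLE S M m → n ≤ m

/-- `N ∈ T^⊥`: `Ext^i_S(T, N) = 0` for all `i ≥ 1`. -/
def MemPerp (S : Type u) [Ring S] (T N : ModuleCat.{u} S) : Prop :=
  ∀ i, 1 ≤ i → ExtVanish S i T N

/-- `N ∈ X_T = T^⊥ ∩ gen*_S(T)`. -/
def MemXT (S : Type u) [Ring S] (T N : ModuleCat.{u} S) : Prop :=
  MemPerp S T N ∧ MemGenStar S T N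

/-- There is an exact sequence `0 → B → X_0 → ⋯ → X_n → 0` with all `X_i ∈ add_S T`. -/
def HasFiniteAddCoresolution (S : Type u) [Ring S] (T B : ModuleCat.{u} S) (n : ℕ) : Prop :=
  ∃ (X : ℕ → ModuleCat.{u} S) (g : ∀ i, ↥(X i) →ₗ[S] ↥(X (i + 1))) (g0 : ↥B →ₗ[S] ↥(X 0)),
    (∀ i, i ≤ n → MemAdd S T (X i)) ∧
    (∀ i, n < i → Subsingleton ↥(X i)) ∧
    Function.Injective g0 ∧
    Function.Exact g0 (g 0) ∧
    (∀ i, Function.Exact (g i) (g (i + 1)))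

/-- `T` is an `n`-tilting left `A`-module (Miyashita); applying this with `A = Rᵐᵒᵖ`
gives the notion for right `R`-modules. -/
def IsNTilting (A : Type u) [Ring A] (T : ModuleCat.{u} A) (n : ℕ) : Prop :=
  MemGenStar A (ModuleCat.of A A) T ∧
  PdLE A T n ∧
  (∀ i, 0 < i → ExtVanish A i T T) ∧
  HasFiniteAddCoresolution A T (ModuleCat.of A A) n

/-- `T` is a Wakamatsu tilting left `A`-module (Definition 2.2); applying this with
`A = Rᵐᵒᵖ` gives the notion for right `R`-modules: `T ∈ gen*(A)`, `Ext^i_A(T,T) = 0` for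
`i > 0`, and there is an exact sequence `0 → A → X_0 → X_1 → ⋯` with `X_i ∈ add T`
which stays exact after applying `Hom_A(-, T)`. -/
def IsWakamatsuTilting (A : Type u) [Ring A] (T : ModuleCat.{u} A) : Prop :=
  MemGenStar A (ModuleCat.of A A) T ∧
  (∀ i, 0 < i → ExtVanish A i T T) ∧
  ∃ (X : ℕ → ModuleCat.{u} A) (g : ∀ i, ↥(X i) →ₗ[A] ↥(X (i + 1))) (g0 : A →ₗ[A] ↥(X 0)),
    (∀ i, MemAdd A T (X i)) ∧
    Function.Injective g0 ∧
    Function.Exact g0 (g 0) ∧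
    (∀ i, Function.Exact (g i) (g (i + 1))) ∧
    Function.Surjective (fun h : ↥(X 0) →ₗ[A] ↥T => h.comp g0) ∧
    Function.Exact (fun h : ↥(X 1) →ₗ[A] ↥T => h.comp (g 0))
      (fun h : ↥(X 0) →ₗ[A] ↥T => h.comp g0) ∧
    (∀ i, Function.Exact (fun h : ↥(X (i + 2)) →ₗ[A] ↥T => h.comp (g (i + 1)))
      (fun h : ↥(X (i + 1)) →ₗ[A] ↥T => h.comp (g i)))

/-- The subgroup of `T ⊗_ℤ M` generated by the balancing relations `(t·r) ⊗ m - t ⊗ (r·m)`;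
the quotient of `T ⊗_ℤ M` by it is the balanced tensor product `T ⊗_R M`. -/
noncomputable def TensorRel (R : Type u) [Ring R] (T : Type u) [AddCommGroup T]
    [Module Rᵐᵒᵖ T] (M : Type u) [AddCommGroup M] [Module R M] :
    AddSubgroup (TensorProduct ℤ T M) :=
  AddSubgroup.closure
    {x | ∃ (t : T) (r : R) (m : M),
      x = (MulOpposite.op r • t) ⊗ₜ[ℤ] m - t ⊗ₜ[ℤ] (r • m)}

/-- The right `R`-module `T` is tensorly faithful: `T ⊗_R M ≠ 0` for every nonzero left
`R`-module `M` (equivalently, the balancing relations do not exhaust `T ⊗_ℤ M`). -/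
def TensorlyFaithful (R : Type u) [Ring R] (T : Type u) [AddCommGroup T]
    [Module Rᵐᵒᵖ T] : Prop :=
  ∀ (M : Type u) [AddCommGroup M] [Module R M], Nontrivial M → TensorRel R T M ≠ ⊤

/-- The natural ring homomorphism `Rᵐᵒᵖ →+* End(_S T)` induced by the right `R`-action;
it being bijective says exactly that `R → End(_S T)ᵒᵖ` is an isomorphism. -/
def rightEndNat (S R : Type u) [Ring S] [Ring R] (T : Type u) [AddCommGroup T] [Module S T]
    [Module Rᵐᵒᵖ T] [SMulCommClass S Rᵐᵒᵖ T] : Rᵐᵒᵖ →+* Module.End S T :=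
  haveI := SMulCommClass.symm S Rᵐᵒᵖ T
  Module.toModuleEnd S T

/-- The bimodule `T` is Wakamatsu tilting, i.e. a semidualizing `(S,R)`-bimodule
(Lemma 2.3(iii)). -/
def IsSemidualizing (S R : Type u) [Ring S] [Ring R] (T : Type u) [AddCommGroup T]
    [Module S T] [Module Rᵐᵒᵖ T] [SMulCommClass S Rᵐᵒᵖ T] : Prop :=
  MemGenStar Rᵐᵒᵖ (ModuleCat.of Rᵐᵒᵖ Rᵐᵒᵖ) (ModuleCat.of Rᵐᵒᵖ T) ∧
  MemGenStar S (ModuleCat.of S S) (ModuleCat.of S T) ∧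
  Function.Bijective (Module.toModuleEnd Rᵐᵒᵖ T : S →+* Module.End Rᵐᵒᵖ T) ∧
  Function.Bijective (rightEndNat S R T) ∧
  (∀ i, 0 < i → ExtVanish Rᵐᵒᵖ i (ModuleCat.of Rᵐᵒᵖ T) (ModuleCat.of Rᵐᵒᵖ T)) ∧
  (∀ i, 0 < i → ExtVanish S i (ModuleCat.of S T) (ModuleCat.of S T))

/-- The left `R`-module structure on `Hom_S(T, M)` given by `(r • f) t = f (t · r)`. -/
def homModule (S R : Type u) [Ring S] [Ring R] (T : Type u) [AddCommGroup T] [Module S T]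
    [Module Rᵐᵒᵖ T] [SMulCommClass S Rᵐᵒᵖ T] (M : Type u) [AddCommGroup M] [Module S M] :
    Module R (T →ₗ[S] M) where
  smul r f :=
    { toFun := fun t => f (MulOpposite.op r • t)
      map_add' := fun t₁ t₂ => by
        show f (MulOpposite.op r • (t₁ + t₂)) = _
        rw [smul_add, map_add]
      map_smul' := fun s t => by
        show f (MulOpposite.op r • (s • t)) = s • f (MulOpposite.op r • t)
        rw [← smul_comm s (MulOpposite.op r) t, map_smul] }
  one_smul f := by
    apply LinearMap.ext; intro t
    show f ((MulOpposite.op (1 : R)) • t) = f t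
    rw [MulOpposite.op_one, one_smul]
  mul_smul r₁ r₂ f := by
    apply LinearMap.ext; intro t
    show f ((MulOpposite.op (r₁ * r₂)) • t) = f (MulOpposite.op r₂ • MulOpposite.op r₁ • t)
    rw [MulOpposite.op_mul, mul_smul]
  smul_zero r := by apply LinearMap.ext; intro t; rfl
  smul_add r f g := by apply LinearMap.ext; intro t; rfl
  add_smul r₁ r₂ f := by
    apply LinearMap.ext; intro t
    show f ((MulOpposite.op (r₁ + r₂)) • t) = f (MulOpposite.op r₁ • t) + f (MulOpposite.op r₂ • t)
    rw [MulOpposite.op_add, add_smul, map_add]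
  zero_smul f := by
    apply LinearMap.ext; intro t
    show f ((MulOpposite.op (0 : R)) • t) = 0
    rw [MulOpposite.op_zero, zero_smul, map_zero]

/-- The evaluation map `T ⊗_ℤ Hom_S(T, M) → M`, `t ⊗ h ↦ h t`. -/
noncomputable def evalMap (S : Type u) [Ring S] (T : Type u) [AddCommGroup T] [Module S T]
    (M : Type u) [AddCommGroup M] [Module S M] :
    TensorProduct ℤ T (T →ₗ[S] M) →ₗ[ℤ] M :=
  TensorProduct.lift
    (LinearMap.mk₂ ℤ (fun t h => h t)
      (fun t₁ t₂ h => by show h (t₁ + t₂) = h t₁ + h t₂; rw [map_add])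
      (fun z t h => by show h (z • t) = z • h t; rw [map_zsmul])
      (fun t h₁ h₂ => rfl)
      (fun z t h => rfl))

/-- `Tor^R_i(T, N) = 0` for all `i ≥ 1`: for every projective resolution `P_•` of the left
`R`-module `N`, the induced complex `T ⊗_R P_•` is exact in positive degrees (expressed
via the presentation of `T ⊗_R -` as a quotient of `T ⊗_ℤ -` by the balancing relations). -/
def TorVanishPos (R : Type u) [Ring R] (T : Type u) [AddCommGroup T] [Module Rᵐᵒᵖ T]
    (N : Type u) [AddCommGroup N] [Module R N] : Prop :=
  ∀ (P : ℕ → ModuleCat.{u} R) (d : ∀ i, ↥(P (i + 1)) →ₗ[R] ↥(P i)) (ε : ↥(P 0) →ₗ[R] N),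
    (∀ i, Module.Projective R ↥(P i)) → Function.Surjective ε →
    Function.Exact (d 0) ε → (∀ i, Function.Exact (d (i + 1)) (d i)) →
    ∀ (i : ℕ) (x : TensorProduct ℤ T ↥(P (i + 1))),
      TensorProduct.map (LinearMap.id : T →ₗ[ℤ] T)
          ((d i).toAddMonoidHom.toIntLinearMap) x ∈ TensorRel R T ↥(P i) →
      ∃ y : TensorProduct ℤ T ↥(P (i + 2)),
        x - TensorProduct.map (LinearMap.id : T →ₗ[ℤ] T)
          ((d (i + 1)).toAddMonoidHom.toIntLinearMap) y ∈ TensorRel R T ↥(P (i + 1))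

/-- `M` belongs to the Bass class `B_T(S)`: the evaluation map
`T ⊗_R Hom_S(T, M) → M` is an isomorphism (it is surjective, and its kernel is exactly the
subgroup of balancing relations), `Ext^i_S(T, M) = 0` and `Tor^R_i(T, Hom_S(T, M)) = 0`
for all `i ≥ 1`. -/
def MemBass (S R : Type u) [Ring S] [Ring R] (T : Type u) [AddCommGroup T] [Module S T]
    [Module Rᵐᵒᵖ T] [SMulCommClass S Rᵐᵒᵖ T] (M : Type u) [AddCommGroup M] [Module S M] :
    Prop :=
  letI := homModule S R T M
  Function.Surjective (evalMap S T M) ∧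
  (∀ x, evalMap S T M x = 0 ↔ x ∈ TensorRel R T (T →ₗ[S] M)) ∧
  (∀ i, 1 ≤ i → ExtVanish S i (ModuleCat.of S T) (ModuleCat.of S M)) ∧
  TorVanishPos R T (T →ₗ[S] M)

/-- `R` is a left max ring: every nonzero left `R`-module has a maximal (proper) submodule. -/
def IsLeftMaxRing (R : Type u) [Ring R] : Prop :=
  ∀ (M : Type u) [AddCommGroup M] [Module R M], Nontrivial M → ∃ N : Submodule R M, IsCoatom N

/-- `R` is left Kasch: every simple quotient `R/n` by a maximal left ideal embeds as a
left ideal of `R`. -/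
def IsLeftKasch (R : Type u) [Ring R] : Prop :=
  ∀ n : Submodule R R, IsCoatom n → ∃ I : Submodule R R, Nonempty ((R ⧸ n) ≃ₗ[R] ↥I)


/-- In a commutative Artinian ring, the double annihilator of the Jacobson radical is contained
in the Jacobson radical. -/
theorem IsArtinianRing.mem_jacobson_of_annihilator_annihilator
    {A : Type*} [CommRing A] [IsArtinianRing A] {a : A}
    (ha : ∀ s : A, (∀ j ∈ Ring.jacobson A, s * j = 0) → s * a = 0) : a ∈ Ring.jacobson A := by
  rw [Ring.jacobson_eq_sInf_isMaximal, Ideal.mem_sInf]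
  intro m hm
  have hm' : m.IsMaximal := hm
  have : IsFractionRing A A := IsFractionRing.self_iff_nonZeroDivisors_le_isUnit.mpr
    fun _ ha ↦ IsArtinianRing.isUnit_of_mem_nonZeroDivisors ha
  obtain ⟨-, s, hs⟩ := isAssociatedPrime_iff.mp (AssociatedPrimes.mem_iff.mp
    (Ideal.IsMaximal.mem_associatedPrimes_of_isFractionRing (I := m)))
  have mem_iff (b : A) : b ∈ m ↔ s * b = 0 := by
    rw [hs, Submodule.mem_colon_singleton, Submodule.mem_bot, smul_eq_mul, mul_comm]
  refine (mem_iff a).mpr (ha s fun j hj ↦ (mem_iff j).mp ?_)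
  rw [Ring.jacobson_eq_sInf_isMaximal, Ideal.mem_sInf] at hj
  exact hj hm

/-- An element of a projective module killed by every `s ∈ S` lies in `I • ⊤`, as soon as `I`
contains the annihilator of `S`. -/
theorem Module.Projective.mem_smul_top_of_forall_smul_eq_zero
    {A P : Type*} [CommRing A] [AddCommGroup P] [Module A P] [Module.Projective A P]
    {S : Set A} {I : Ideal A} (hI : ∀ a : A, (∀ s ∈ S, s * a = 0) → a ∈ I)
    {x : P} (hx : ∀ s ∈ S, s • x = 0) : x ∈ I • (⊤ : Submodule A P) := by
  obtain ⟨σ, hσ⟩ := (inferInstance : Module.Projective A P).out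
  rw [← hσ x, Finsupp.linearCombination_apply]
  refine Submodule.sum_mem _ fun p _ ↦ Submodule.smul_mem_smul (hI _ fun s hs ↦ ?_) trivial
  rw [← smul_eq_mul, ← Finsupp.smul_apply, ← map_smul, hx s hs, map_zero, Finsupp.zero_apply]

/-- An injective linear map between projective modules over a commutative Artinian ring has a
retraction. -/
theorem IsArtinianRing.exists_leftInverse_of_injective_of_projective
    {A P Q : Type*} [CommRing A] [IsArtinianRing A] [AddCommGroup P] [Module A P]
    [Module.Projective A P] [AddCommGroup Q] [Module A Q] [Module.Projective A Q]
    (f : P →ₗ[A] Q) (hf : Function.Injective f) : ∃ r : Q →ₗ[A] P, r ∘ₗ f = LinearMap.id := by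
  set J : Ideal A := Ring.jacobson A
  set JP : Submodule A P := J • ⊤ with hJP
  set JQ : Submodule A Q := J • ⊤ with hJQ
  have hle : JP ≤ JQ.comap f := by
    rw [hJP, Submodule.smul_le]
    intro a ha p _
    rw [Submodule.mem_comap, map_smul]
    exact Submodule.smul_mem_smul ha trivial
  have hge (x : P) (hx : f x ∈ JQ) : x ∈ JP := by
    refine Module.Projective.mem_smul_top_of_forall_smul_eq_zero
      (S := {s | ∀ j ∈ J, s * j = 0})
      (fun a ha ↦ IsArtinianRing.mem_jacobson_of_annihilator_annihilator ha) fun s hs ↦ hf ?_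
    rw [map_smul, map_zero]
    refine Submodule.smul_induction_on hx (fun j hj q _ ↦ ?_) fun y z hy hz ↦ ?_
    · rw [← mul_smul, hs j hj, zero_smul]
    · rw [smul_add, hy, hz, add_zero]
  have hinj : Function.Injective (JP.mapQ JQ f hle) := by
    rw [injective_iff_map_eq_zero]
    intro x
    obtain ⟨x, rfl⟩ := JP.mkQ_surjective x
    simpa using hge x
  have hss : IsSemisimpleModule A (Q ⧸ JQ) := by
    have htors : Module.IsTorsionBySet A (Q ⧸ JQ) (J : Set A) :=
      Module.isTorsionBySet_quotient_ideal_smul Q J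
    let := htors.module
    exact htors.isSemisimpleModule_iff.mp inferInstance
  obtain ⟨r, hr⟩ := IsSemisimpleModule.extension_property _ hinj LinearMap.id
  obtain ⟨g, hg⟩ := Module.projective_lifting_property JP.mkQ (r ∘ₗ JQ.mkQ) JP.mkQ_surjective
  have hgf (x : P) : (g ∘ₗ f - LinearMap.id : Module.End A P) x ∈ JP := by
    rw [← Submodule.Quotient.mk_eq_zero, ← Submodule.mkQ_apply, LinearMap.sub_apply, map_sub,
      sub_eq_zero]
    exact (LinearMap.congr_fun hg (f x)).trans (LinearMap.congr_fun hr (JP.mkQ x))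
  obtain ⟨n, hn⟩ : IsNilpotent J := IsSemiprimaryRing.isNilpotent
  have hpow (k : ℕ) (x : P) :
      ((g ∘ₗ f - LinearMap.id : Module.End A P) ^ k) x ∈ J ^ k • (⊤ : Submodule A P) := by
    induction k with
    | zero => simp
    | succ k ih =>
      rw [pow_succ (M := Ideal A), pow_succ' (M := Module.End A P), Module.End.mul_apply, mul_smul]
      refine Submodule.smul_induction_on ih (fun j hj p _ ↦ ?_) fun y z hy hz ↦ ?_
      · rw [map_smul]
        exact Submodule.smul_mem_smul hj (hgf p)
      · rw [map_add]
        exact add_mem hy hz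
  have hnil : IsNilpotent (g ∘ₗ f - LinearMap.id : Module.End A P) := by
    refine ⟨n, LinearMap.ext fun x ↦ ?_⟩
    simpa [hn] using hpow n x
  have hunit : IsUnit (g ∘ₗ f : Module.End A P) := by
    have := hnil.isUnit_one_add
    rwa [Module.End.one_eq_id, add_sub_cancel] at this
  obtain ⟨u, hu⟩ := hunit
  refine ⟨(↑u⁻¹ : Module.End A P) ∘ₗ g, ?_⟩
  rw [LinearMap.comp_assoc, ← hu]
  exact u.inv_mul

/-- Restricting scalars along a free algebra preserves projectivity. -/
theorem Module.Projective.of_free_algebra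
    (A S : Type*) {P : Type*} [CommRing A] [Ring S] [Algebra A S] [Module.Free A S]
    [AddCommGroup P] [Module A P] [Module S P] [IsScalarTower A S P] [Module.Projective S P] :
    Module.Projective A P := by
  obtain ⟨σ, hσ⟩ := (inferInstance : Module.Projective S P).out
  exact .of_split (σ.restrictScalars A) ((Finsupp.linearCombination S id).restrictScalars A)
    (LinearMap.ext hσ)

/-- Let `u : H → S` be a homomorphism from a finite group to an `A`-algebra whose image spans `S`,
and suppose that the identity of `S` is the average over `H` of an `A`-linear endomorphism. Then an
`S`-linear map with projective domain has an `S`-linear retraction if it has an `A`-linear one. -/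
theorem Module.Projective.exists_leftInverse_of_restrictScalars
    {A S H P Q : Type*} [CommRing A] [Ring S] [Algebra A S] [Group H] [Fintype H]
    (u : H →* S) (hu : Submodule.span A (Set.range u) = ⊤)
    (θ : S →ₗ[A] S) (hθ : ∀ s, ∑ h, u h * θ (u h⁻¹ * s) = s)
    [AddCommGroup P] [Module A P] [Module S P] [IsScalarTower A S P] [Module.Projective S P]
    [AddCommGroup Q] [Module A Q] [Module S Q] [IsScalarTower A S Q]
    (f : P →ₗ[S] Q) (r : Q →ₗ[A] P) (hr : ∀ x, r (f x) = x) :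
    ∃ r' : Q →ₗ[S] P, r' ∘ₗ f = LinearMap.id := by
  obtain ⟨σ, hσ⟩ := (inferInstance : Module.Projective S P).out
  let π : (P →₀ S) →ₗ[S] P := Finsupp.linearCombination S id
  let Θ : P →ₗ[A] P :=
    π.restrictScalars A ∘ₗ Finsupp.mapRange.linearMap θ ∘ₗ σ.restrictScalars A
  have hΘ (x : P) : ∑ h, u h • Θ (u h⁻¹ • x) = x := by
    have (y : P →₀ S) :
        ∑ h, u h • Finsupp.mapRange.linearMap (α := P) θ (u h⁻¹ • y) = y := by
      ext p
      simp [Finsupp.finsetSum_apply, hθ]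
    calc ∑ h, u h • Θ (u h⁻¹ • x)
        = π (∑ h, u h • Finsupp.mapRange.linearMap (α := P) θ (u h⁻¹ • σ x)) := by
          simp [Θ, map_sum]
      _ = x := by rw [this]; exact hσ x
  let ρ : Q →ₗ[A] P :=
    ∑ h, (Algebra.lsmul A A P (u h)) ∘ₗ Θ ∘ₗ r ∘ₗ (Algebra.lsmul A A Q (u h⁻¹))
  have hρ (q : Q) : ρ q = ∑ h, u h • Θ (r (u h⁻¹ • q)) := by simp [ρ]
  have hρu (k : H) (q : Q) : ρ (u k • q) = u k • ρ q := by
    rw [hρ, hρ, Finset.smul_sum, ← Equiv.sum_comp (Equiv.mulLeft k)]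
    simp [← mul_smul, ← map_mul]
  have hρS (s : S) (q : Q) : ρ (s • q) = s • ρ q := by
    have hs : s ∈ Submodule.span A (Set.range u) := hu ▸ trivial
    induction hs using Submodule.span_induction with
    | mem s hs => obtain ⟨k, rfl⟩ := hs; exact hρu k q
    | zero => simp
    | add s t _ _ hs ht => rw [add_smul, map_add, hs, ht, add_smul]
    | smul a s _ hs => rw [smul_assoc, map_smul, hs, smul_assoc]
  refine ⟨{ toFun := ρ, map_add' := ρ.map_add, map_smul' := hρS }, LinearMap.ext fun x ↦ ?_⟩
  change ρ (f x) = x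
  simp_rw [hρ, ← map_smul, hr]
  exact hΘ x

/-- An injective linear map between projective right modules over the group ring of a finite group
over a commutative Artinian ring has a retraction. -/
theorem MonoidAlgebra.exists_leftInverse_of_injective_of_projective
    {A G P Q : Type*} [CommRing A] [IsArtinianRing A] [Group G] [Finite G]
    [AddCommGroup P] [Module (MonoidAlgebra A G)ᵐᵒᵖ P] [Module.Projective (MonoidAlgebra A G)ᵐᵒᵖ P]
    [AddCommGroup Q] [Module (MonoidAlgebra A G)ᵐᵒᵖ Q] [Module.Projective (MonoidAlgebra A G)ᵐᵒᵖ Q]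
    (f : P →ₗ[(MonoidAlgebra A G)ᵐᵒᵖ] Q) (hf : Function.Injective f) :
    ∃ r : Q →ₗ[(MonoidAlgebra A G)ᵐᵒᵖ] P, r ∘ₗ f = LinearMap.id := by
  have : Finite Gᵐᵒᵖ := .of_equiv G MulOpposite.opEquiv
  let := Fintype.ofFinite Gᵐᵒᵖ
  let S := (MonoidAlgebra A G)ᵐᵒᵖ
  let : Module A P := Module.compHom P (algebraMap A S)
  let : Module A Q := Module.compHom Q (algebraMap A S)
  have : IsScalarTower A S P := .of_algebraMap_smul fun _ _ ↦ rfl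
  have : IsScalarTower A S Q := .of_algebraMap_smul fun _ _ ↦ rfl
  have : Module.Free A S := .of_equiv (MulOpposite.opLinearEquiv A (M := MonoidAlgebra A G))
  have : Module.Projective A P := .of_free_algebra A S
  have : Module.Projective A Q := .of_free_algebra A S
  obtain ⟨r, hr⟩ := IsArtinianRing.exists_leftInverse_of_injective_of_projective
    (f.restrictScalars A) hf
  let u : Gᵐᵒᵖ →* S := (MonoidAlgebra.of A G).op
  have hu : Submodule.span A (Set.range u) = ⊤ := by
    rw [eq_top_iff]
    rintro s -
    obtain ⟨s, rfl⟩ := MulOpposite.op_surjective s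
    induction s using MonoidAlgebra.induction_linear with
    | zero => exact zero_mem _
    | add s t hs ht => exact add_mem hs ht
    | single g a =>
      have : MulOpposite.op (MonoidAlgebra.single g a) = a • u (MulOpposite.op g) := by
        change _ = MulOpposite.op (a • MonoidAlgebra.single g 1)
        rw [MonoidAlgebra.smul_single, smul_eq_mul, mul_one]
      rw [this]
      exact Submodule.smul_mem _ _ (Submodule.subset_span ⟨_, rfl⟩)
  let θ : S →ₗ[A] S := Algebra.linearMap A S ∘ₗ
    { toFun := fun s ↦ s.unop.coeff 1, map_add' := fun _ _ ↦ rfl, map_smul' := fun _ _ ↦ rfl }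
  refine Module.Projective.exists_leftInverse_of_restrictScalars u hu θ (fun s ↦ ?_) f r
    (LinearMap.congr_fun hr)
  obtain ⟨s, rfl⟩ := MulOpposite.op_surjective s
  apply MulOpposite.unop_injective
  ext g
  have hterm (h : Gᵐᵒᵖ) : (u h * θ (u h⁻¹ * MulOpposite.op s)).unop =
      MonoidAlgebra.single h.unop (s.coeff h.unop) := by
    change algebraMap A (MonoidAlgebra A G)
      ((s * MonoidAlgebra.single h.unop⁻¹ 1).coeff 1) * MonoidAlgebra.single h.unop 1 = _
    simp [MonoidAlgebra.coeff_mul_single_apply]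
  let := Fintype.ofFinite G
  have hsum : (∑ h, u h * θ (u h⁻¹ * MulOpposite.op s)).unop =
      ∑ h : G, MonoidAlgebra.single h (s.coeff h) := by
    refine (Finset.unop_sum _ _).trans ?_
    simp_rw [hterm]
    exact MulOpposite.opEquiv.symm.sum_comp fun h ↦ MonoidAlgebra.single h (s.coeff h)
  rw [hsum, MonoidAlgebra.coeff_sum]
  simp

/-- Over a ring for which every injective map between projective modules splits, every module of
finite projective dimension is projective. -/
theorem PdLE.projective {S : Type u} [Ring S]
    (hS : ∀ (P Q : ModuleCat.{u} S) [Module.Projective S P] [Module.Projective S Q]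
      (f : P →ₗ[S] Q), Function.Injective f → ∃ r : Q →ₗ[S] P, r ∘ₗ f = LinearMap.id)
    {M : ModuleCat.{u} S} {n : ℕ} (h : PdLE S M n) : Module.Projective S M := by
  induction n generalizing M with
  | zero =>
    obtain ⟨P, d, ε, hP, hε, hdε, -, hsub⟩ := h
    have := hP 0
    have := hsub 1 one_pos
    have hinj : Function.Injective ε := by
      rw [injective_iff_map_eq_zero]
      intro x hx
      obtain ⟨y, rfl⟩ := (hdε x).mp hx
      rw [Subsingleton.elim y 0, map_zero]
    exact .of_equiv (LinearEquiv.ofBijective ε ⟨hinj, hε⟩)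
  | succ n ih =>
    obtain ⟨P, d, ε, hP, hε, hdε, hd, hsub⟩ := h
    have := hP 0
    have hK : PdLE S (ModuleCat.of S (LinearMap.ker ε)) n := by
      refine ⟨fun i ↦ P (i + 1), fun i ↦ d (i + 1),
        (d 0).codRestrict (LinearMap.ker ε) hdε.apply_apply_eq_zero, fun i ↦ hP _, ?_, ?_,
        fun i ↦ hd _, fun i hi ↦ hsub _ (Nat.succ_lt_succ hi)⟩
      · rintro ⟨x, hx⟩
        obtain ⟨y, rfl⟩ := (hdε x).mp hx
        exact ⟨y, rfl⟩
      · intro x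
        rw [← hd 0 x, Subtype.ext_iff]
        rfl
    have := ih hK
    have hr := hS (ModuleCat.of S (LinearMap.ker ε)) (P 0) (LinearMap.ker ε).subtype
      Subtype.val_injective
    obtain ⟨s, hs⟩ := ((LinearMap.exact_subtype_ker_map ε).split_tfae Subtype.val_injective hε).out 0 1
      |>.mpr hr
    exact .of_split s ε hs

/-- Remark 2.15(iv), part of Corollary 1.2. Let `R = A[G]` be the group
ring of a finite group `G` over a commutative Artinian ring `A`. Then every Wakamatsu
tilting right `R`-module of finite projective dimension is projective; in particular, the
Wakamatsu tilting conjecture holds for `R`. -/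
theorem wtc_of_group_ring
    (A : Type u) [CommRing A] [IsArtinianRing A] (G : Type u) [Group G] [Finite G]
    (T : Type u) [AddCommGroup T] [Module (MonoidAlgebra A G)ᵐᵒᵖ T]
    (hWT : IsWakamatsuTilting (MonoidAlgebra A G)ᵐᵒᵖ
      (ModuleCat.of (MonoidAlgebra A G)ᵐᵒᵖ T))
    (hpd : ∃ n : ℕ, PdLE (MonoidAlgebra A G)ᵐᵒᵖ
      (ModuleCat.of (MonoidAlgebra A G)ᵐᵒᵖ T) n) :
    Module.Projective (MonoidAlgebra A G)ᵐᵒᵖ T := by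
  obtain ⟨n, hn⟩ := hpd
  exact hn.projective fun P Q _ _ f hf ↦
    MonoidAlgebra.exists_leftInverse_of_injective_of_projective f hf
end

section
/- Let S and R be associative rings with identity and let T be an (S,R)-bimodule that is Wakamatsu tilting, with projective dimension of T as a right R-module equal to n < ∞. Then there exists an exact sequence 0 → S → T_0 → T_1 → ⋯ → T_n → 0 of left S-modules with each T_i ∈ add_S T. -/
/-!
Common definitions for formalizing the Wakamatsu tilting conjecture paper.
All rings are associative with identity; right `R`-modules are treated as
left `Rᵐᵒᵖ`-modules.
-/

open CategoryTheory

universe u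

namespace ModuleCat

variable {A : Type u} [Ring A]

/-- The chain complex attached to a sequence of linear maps with zero composites. -/
noncomputable def chainComplexOfExact (X : ℕ → ModuleCat.{u} A)
    (f : ∀ i, ↥(X (i + 1)) →ₗ[A] ↥(X i)) (hf : ∀ i, Function.Exact (f (i + 1)) (f i)) :
    ChainComplex (ModuleCat.{u} A) ℕ :=
  ChainComplex.of X (fun i => ModuleCat.ofHom (f i)) fun i => by
    rw [← ModuleCat.ofHom_comp, (hf i).linearMap_comp_eq_zero]; rfl

lemma chainComplexOfExact_d (X : ℕ → ModuleCat.{u} A)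
    (f : ∀ i, ↥(X (i + 1)) →ₗ[A] ↥(X i)) (hf : ∀ i, Function.Exact (f (i + 1)) (f i)) (i : ℕ) :
    (chainComplexOfExact X f hf).d (i + 1) i = ModuleCat.ofHom (f i) :=
  ChainComplex.of_d (X := X) (d := fun i => ModuleCat.ofHom (f i)) i

/-- The projective resolution attached to an exact sequence of linear maps. -/
noncomputable def projectiveResolutionOfExact {M : ModuleCat.{u} A} (X : ℕ → ModuleCat.{u} A)
    (f : ∀ i, ↥(X (i + 1)) →ₗ[A] ↥(X i)) (f0 : ↥(X 0) →ₗ[A] ↥M)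
    (hX : ∀ i, Module.Projective A ↥(X i)) (hf0 : Function.Surjective f0)
    (h0 : Function.Exact (f 0) f0) (hf : ∀ i, Function.Exact (f (i + 1)) (f i)) :
    ProjectiveResolution M where
  complex := chainComplexOfExact X f hf
  projective i := (IsProjective.iff_projective (X i)).1 (hX i)
  π := (ChainComplex.toSingle₀Equiv _ _).symm ⟨ModuleCat.ofHom f0, by
    rw [chainComplexOfExact_d]
    exact (ModuleCat.ofHom_comp _ _).symm.trans
      (congrArg ModuleCat.ofHom h0.linearMap_comp_eq_zero)⟩
  quasiIso := ⟨fun m => by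
    cases m with
    | zero =>
      rw [ChainComplex.quasiIsoAt₀_iff, ShortComplex.quasiIso_iff_of_zeros' _ rfl rfl rfl]
      refine (ShortComplex.exact_and_epi_g_iff_of_iso (S₂ := ShortComplex.mk
        (ModuleCat.ofHom (f 0)) (ModuleCat.ofHom f0) ?_) ?_).2 ⟨?_, ?_⟩
      · rw [← ModuleCat.ofHom_comp, h0.linearMap_comp_eq_zero]; rfl
      · refine ShortComplex.isoMk (Iso.refl _) (Iso.refl _) (Iso.refl _) ?_ ?_
        · exact (Category.id_comp _).trans ((chainComplexOfExact_d X f hf 0).symm.trans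
            (Category.comp_id _).symm)
        · refine (Category.id_comp _).trans (Eq.trans ?_ (Category.comp_id _).symm)
          exact (ChainComplex.toSingle₀Equiv_symm_apply_f_zero
            (C := chainComplexOfExact X f hf) (X := M) (ModuleCat.ofHom f0) _).symm
      · rw [ShortComplex.ShortExact.moduleCat_exact_iff_function_exact]
        exact h0
      · exact (ModuleCat.epi_iff_surjective _).2 hf0
    | succ m =>
      rw [quasiIsoAt_iff_exactAt' (hL := ChainComplex.exactAt_succ_single_obj ..),
        HomologicalComplex.exactAt_iff' _ (m + 2) (m + 1) m (by simp) (by simp),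
        ShortComplex.ShortExact.moduleCat_exact_iff_function_exact]
      change Function.Exact ((chainComplexOfExact X f hf).d (m + 2) (m + 1))
        ((chainComplexOfExact X f hf).d (m + 1) m)
      rw [chainComplexOfExact_d, chainComplexOfExact_d]
      exact hf m⟩

/-- If `Ext^{i+1}(M, Y) = 0`, then applying `Hom(-, Y)` to a projective resolution of `M` gives a
complex which is exact in degree `i + 1`. -/
lemma exists_comp_eq_of_extVanish {M Y : ModuleCat.{u} A} (X : ℕ → ModuleCat.{u} A)
    (f : ∀ i, ↥(X (i + 1)) →ₗ[A] ↥(X i)) (f0 : ↥(X 0) →ₗ[A] ↥M)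
    (hX : ∀ i, Module.Projective A ↥(X i)) (hf0 : Function.Surjective f0)
    (h0 : Function.Exact (f 0) f0) (hf : ∀ i, Function.Exact (f (i + 1)) (f i))
    (i : ℕ) (hext : ExtVanish A (i + 1) M Y) (h : ↥(X (i + 1)) →ₗ[A] ↥Y)
    (hh : h ∘ₗ f (i + 1) = 0) : ∃ g : ↥(X i) →ₗ[A] ↥Y, g ∘ₗ f i = h := by
  let P := projectiveResolutionOfExact X f f0 hX hf0 h0 hf
  have hd (i : ℕ) : P.complex.d (i + 1) i = ModuleCat.ofHom (f i) :=
    chainComplexOfExact_d X f hf i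
  have hz : Limits.IsZero ((P.complex.linearYonedaObj ℤ Y).homology (i + 1)) :=
    (ModuleCat.isZero_of_subsingleton _).of_iso (P.isoExt (i + 1) Y).symm
  rw [← HomologicalComplex.exactAt_iff_isZero_homology,
    HomologicalComplex.exactAt_iff' _ i (i + 1) (i + 2) (by simp) (by simp),
    ShortComplex.moduleCat_exact_iff] at hz
  obtain ⟨g, hg⟩ := hz (ModuleCat.ofHom h) (by
    change P.complex.d (i + 2) (i + 1) ≫ ModuleCat.ofHom h = 0
    rw [hd]
    exact (ModuleCat.ofHom_comp _ _).symm.trans (congrArg ModuleCat.ofHom hh))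
  change P.complex.d (i + 1) i ≫ g = ModuleCat.ofHom h at hg
  rw [hd] at hg
  exact ⟨ModuleCat.Hom.hom g, congrArg ModuleCat.Hom.hom hg⟩

/-- The kernel of a surjection from a projective module onto `M` has projective dimension at most
`n` if and only if `M` has projective dimension at most `n + 1`. -/
lemma hasProjectiveDimensionLE_ker_iff {P M : ModuleCat.{u} A} [Module.Projective A P]
    (ε : ↥P →ₗ[A] ↥M) (hε : Function.Surjective ε) (n : ℕ) :
    HasProjectiveDimensionLE M (n + 1) ↔
      HasProjectiveDimensionLE (ModuleCat.of A (LinearMap.ker ε)) n := by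
  have hex : Function.Exact (LinearMap.ker ε).subtype ε := LinearMap.exact_subtype_ker_map ε
  let Sc : ShortComplex (ModuleCat.{u} A) := ShortComplex.mk
    (ModuleCat.ofHom (LinearMap.ker ε).subtype) (ModuleCat.ofHom ε) (by
      rw [← ModuleCat.ofHom_comp, hex.linearMap_comp_eq_zero]; rfl)
  have hS : Sc.ShortExact := ModuleCat.shortComplex_shortExact Sc hex
    (LinearMap.ker ε).injective_subtype hε
  exact hS.hasProjectiveDimensionLT_X₃_iff n
    ((IsProjective.iff_projective (ModuleCat.of A P)).1 inferInstance)

end ModuleCat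

section

variable {A : Type u} [Ring A]

/-- An exact sequence `X₂ → X₁ → X₀ → M` induces an exact sequence `X₂ → X₁ → ker (X₀ → M) → 0`. -/
lemma Function.Exact.exact_codRestrict_ker {X₂ X₁ X₀ M : Type*} [AddCommGroup X₂]
    [AddCommGroup X₁] [AddCommGroup X₀] [AddCommGroup M] [Module A X₂] [Module A X₁]
    [Module A X₀] [Module A M] {f' : X₂ →ₗ[A] X₁} {f : X₁ →ₗ[A] X₀} {f0 : X₀ →ₗ[A] M}
    (h0 : Function.Exact f f0) (h : Function.Exact f' f) :
    Function.Surjective (f.codRestrict (LinearMap.ker f0) h0.apply_apply_eq_zero) ∧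
      Function.Exact f' (f.codRestrict (LinearMap.ker f0) h0.apply_apply_eq_zero) := by
  constructor
  · rintro ⟨x, hx⟩
    obtain ⟨y, rfl⟩ := (h0 x).1 hx
    exact ⟨y, rfl⟩
  · intro y
    rw [← h y, Subtype.ext_iff]
    rfl

lemma PdLE.hasProjectiveDimensionLE {M : ModuleCat.{u} A} {n : ℕ} (h : PdLE A M n) :
    HasProjectiveDimensionLE M n := by
  induction n generalizing M with
  | zero =>
    obtain ⟨P, d, ε, hP, hε, h0, hd, hz⟩ := h
    have hinj : Function.Injective ε := by
      rw [← LinearMap.ker_eq_bot, eq_bot_iff]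
      intro x hx
      obtain ⟨y, rfl⟩ := (h0 x).1 hx
      have := hz 1 one_pos
      rw [Subsingleton.elim y 0, map_zero]
      exact Submodule.zero_mem _
    have := hP 0
    have : Module.Projective A M :=
      Module.Projective.of_equiv (LinearEquiv.ofBijective ε ⟨hinj, hε⟩)
    exact (projective_iff_hasProjectiveDimensionLE_zero _).1
      ((IsProjective.iff_projective (ModuleCat.of A M)).1 this)
  | succ n ih =>
    obtain ⟨P, d, ε, hP, hε, h0, hd, hz⟩ := h
    have := hP 0
    rw [ModuleCat.hasProjectiveDimensionLE_ker_iff ε hε]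
    obtain ⟨hs, he⟩ := h0.exact_codRestrict_ker (hd 0)
    exact ih ⟨fun i => P (i + 1), fun i => d (i + 1), _, fun i => hP _, hs, he,
      fun i => hd _, fun i hi => hz _ (by omega)⟩

lemma MemAdd.projective {X : ModuleCat.{u} A} (h : MemAdd A (ModuleCat.of A A) X) :
    Module.Projective A X := by
  obtain ⟨k, M, ⟨e⟩⟩ := h
  have : Module.Projective A (Fin k → ↥(ModuleCat.of A A)) :=
    inferInstanceAs (Module.Projective A (Fin k → A))
  have : Module.Projective A (X × M) := Module.Projective.of_equiv e.symm
  exact Module.Projective.of_split (LinearMap.inl A X M) (LinearMap.fst A X M)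
    (LinearMap.fst_comp_inl _ _ _)

/-- A projective quotient of an object of `add T` is in `add T`. -/
lemma MemAdd.of_surjective {T X M : ModuleCat.{u} A} (h : MemAdd A T X)
    (f : ↥X →ₗ[A] ↥M) (hf : Function.Surjective f) [Module.Projective A M] : MemAdd A T M := by
  obtain ⟨k, N, ⟨e⟩⟩ := h
  obtain ⟨s, hs⟩ := Module.projective_lifting_property f LinearMap.id hf
  let e' := (Function.Exact.splitSurjectiveEquiv (LinearMap.exact_subtype_ker_map f)
    (LinearMap.ker f).injective_subtype ⟨s, hs⟩).1
  exact ⟨k, ModuleCat.of A (LinearMap.ker f × N),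
    ⟨(LinearEquiv.prodAssoc A M (LinearMap.ker f) N).symm ≪≫ₗ
      (((LinearEquiv.prodComm A M (LinearMap.ker f)).trans e'.symm).prodCongr
        (LinearEquiv.refl A N)) ≪≫ₗ e⟩⟩

variable {S : Type u} [Ring S] {T : Type u} [AddCommGroup T] [Module S T] [Module A T]
  [SMulCommClass A S T]

/-- `Hom_A(-, T)` sends `add A` to `add T`. -/
lemma MemAdd.hom {X : ModuleCat.{u} A} (h : MemAdd A (ModuleCat.of A A) X) :
    MemAdd S (ModuleCat.of S T) (ModuleCat.of S (↥X →ₗ[A] T)) := by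
  obtain ⟨k, M, ⟨e⟩⟩ := h
  exact ⟨k, ModuleCat.of S (↥M →ₗ[A] T),
    ⟨LinearMap.coprodEquiv S ≪≫ₗ LinearEquiv.congrLeft T S e ≪≫ₗ
      (LinearMap.lsum A (fun _ : Fin k => A) S).symm ≪≫ₗ
      LinearEquiv.piCongrRight fun _ => LinearMap.ringLmapEquivSelf A S T⟩⟩

lemma HasFiniteAddCoresolution.of_linearEquiv {U B B' : ModuleCat.{u} S} {n : ℕ}
    (h : HasFiniteAddCoresolution S U B n) (e : ↥B' ≃ₗ[S] ↥B) :
    HasFiniteAddCoresolution S U B' n := by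
  obtain ⟨X, g, g0, hX, hz, hi, h0, hg⟩ := h
  refine ⟨X, g, g0 ∘ₗ e.toLinearMap, hX, hz, hi.comp e.injective, fun x => ?_, hg⟩
  rw [h0 x]
  exact (e.surjective.range_comp g0).symm ▸ Iff.rfl

/-- Splicing a short exact sequence with a coresolution of its last term. -/
lemma HasFiniteAddCoresolution.of_shortExact {U B X₀ C : ModuleCat.{u} S} {n : ℕ}
    (h : HasFiniteAddCoresolution S U C n) (hX₀ : MemAdd S U X₀) (i : ↥B →ₗ[S] ↥X₀)
    (p : ↥X₀ →ₗ[S] ↥C) (hi : Function.Injective i) (hip : Function.Exact i p)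
    (hp : Function.Surjective p) : HasFiniteAddCoresolution S U B (n + 1) := by
  obtain ⟨X, g, g0, hX, hz, hg0, h0, hg⟩ := h
  let Y : ℕ → ModuleCat.{u} S
    | 0 => X₀
    | j + 1 => X j
  let d : ∀ j, ↥(Y j) →ₗ[S] ↥(Y (j + 1))
    | 0 => g0 ∘ₗ p
    | j + 1 => g j
  refine ⟨Y, d, i, ?_, ?_, hi, fun x => ?_, ?_⟩
  · rintro (_ | j) hj
    · exact hX₀
    · exact hX j (by omega)
  · rintro (_ | j) hj
    · omega
    · exact hz j (by omega)
  · rw [← hip x]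
    exact map_eq_zero_iff g0 hg0
  · rintro (_ | j)
    · intro x
      refine (h0 x).trans ?_
      exact (hp.range_comp g0).symm ▸ Iff.rfl
    · exact hg j

lemma hasFiniteAddCoresolution_zero {U B : ModuleCat.{u} S} (h : MemAdd S U B) :
    HasFiniteAddCoresolution S U B 0 := by
  let Y : ℕ → ModuleCat.{u} S
    | 0 => B
    | _ + 1 => ModuleCat.of S PUnit
  have hs : ∀ j, Subsingleton ↥(Y (j + 1)) := fun j => inferInstanceAs (Subsingleton PUnit)
  refine ⟨Y, fun _ => 0, (LinearMap.id : ↥B →ₗ[S] ↥B), ?_, ?_, Function.injective_id, ?_, ?_⟩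
  · rintro j hj
    obtain rfl : j = 0 := by omega
    exact h
  · rintro (_ | j) hj
    · omega
    · exact hs j
  · exact fun x => ⟨fun _ => ⟨x, rfl⟩, fun _ => rfl⟩
  · exact fun j x => ⟨fun _ => ⟨0, (hs j).elim _ _⟩, fun _ => rfl⟩

/-- If `M` has projective dimension at most `n` and a resolution by finitely generated projectives
which stays exact after applying `Hom_A(-, T)`, then `Hom_A(M, T)` has a coresolution of length `n`
by objects of `add T`. -/
lemma hasFiniteAddCoresolution_hom (n : ℕ) {M : ModuleCat.{u} A}
    (hM : HasProjectiveDimensionLE M n) (X : ℕ → ModuleCat.{u} A)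
    (f : ∀ i, ↥(X (i + 1)) →ₗ[A] ↥(X i)) (f0 : ↥(X 0) →ₗ[A] ↥M)
    (hX : ∀ i, MemAdd A (ModuleCat.of A A) (X i)) (hf0 : Function.Surjective f0)
    (h0 : Function.Exact (f 0) f0) (hf : ∀ i, Function.Exact (f (i + 1)) (f i))
    (hT : ∀ i (h : ↥(X (i + 1)) →ₗ[A] T), h ∘ₗ f (i + 1) = 0 →
      ∃ g : ↥(X i) →ₗ[A] T, g ∘ₗ f i = h) :
    HasFiniteAddCoresolution S (ModuleCat.of S T) (ModuleCat.of S (↥M →ₗ[A] T)) n := by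
  induction n generalizing M X with
  | zero =>
    have : Module.Projective A M := (IsProjective.iff_projective (ModuleCat.of A M)).2
      ((projective_iff_hasProjectiveDimensionLE_zero _).2 hM)
    exact hasFiniteAddCoresolution_zero ((hX 0).of_surjective f0 hf0).hom
  | succ n ih =>
    have := (hX 0).projective
    rw [ModuleCat.hasProjectiveDimensionLE_ker_iff f0 hf0] at hM
    obtain ⟨hs, he⟩ := h0.exact_codRestrict_ker (hf 0)
    refine (ih hM (fun i => X (i + 1)) (fun i => f (i + 1)) _ (fun i => hX _) hs he
      (fun i => hf _) (fun i => hT _)).of_shortExact (hX 0).hom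
      (LinearMap.lcomp S T f0) (LinearMap.lcomp S T (LinearMap.ker f0).subtype) ?_ ?_ ?_
    · intro a b hab
      exact LinearMap.cancel_right hf0 |>.1 hab
    · intro g
      constructor
      · intro hg
        have hker : LinearMap.ker f0 ≤ LinearMap.ker g := fun x hx =>
          LinearMap.congr_fun hg ⟨x, hx⟩
        refine ⟨(LinearMap.ker f0).liftQ g hker ∘ₗ
          (f0.quotKerEquivOfSurjective hf0).symm.toLinearMap, ?_⟩
        ext x
        have hx : (f0.quotKerEquivOfSurjective hf0).symm (f0 x) = Submodule.Quotient.mk x := by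
          rw [LinearEquiv.symm_apply_eq]; rfl
        simp [hx]
      · rintro ⟨h, rfl⟩
        ext x
        have hx : f0 x = 0 := x.2
        simp [hx]
    · intro h
      obtain ⟨g, hg⟩ := hT 0 (h ∘ₗ (f 0).codRestrict (LinearMap.ker f0) h0.apply_apply_eq_zero)
        (by rw [LinearMap.comp_assoc, he.linearMap_comp_eq_zero, LinearMap.comp_zero])
      refine ⟨g, ?_⟩
      ext x
      obtain ⟨y, rfl⟩ := hs x
      exact LinearMap.congr_fun hg y

end

/-- part of the proof of Theorem 2.18, via Lemma 2.17(i). Let `T` be a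
Wakamatsu tilting (semidualizing) `(S,R)`-bimodule with `pd(T_R) = n < ∞`. Then there is an
exact sequence `0 → S → T_0 → ⋯ → T_n → 0` of left `S`-modules with all `T_i ∈ add_S T`. -/
theorem exists_finite_add_coresolution_of_pd_eq
    (S R : Type u) [Ring S] [Ring R] (T : Type u) [AddCommGroup T] [Module S T]
    [Module Rᵐᵒᵖ T] [SMulCommClass S Rᵐᵒᵖ T]
    (hsd : IsSemidualizing S R T)
    (n : ℕ) (hpd : PdEq Rᵐᵒᵖ (ModuleCat.of Rᵐᵒᵖ T) n) :
    HasFiniteAddCoresolution S (ModuleCat.of S T) (ModuleCat.of S S) n := by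
  obtain ⟨⟨X, f, f0, hX, hf0, h0, hf, -, -⟩, -, hS, -, hext, -⟩ := hsd
  have := SMulCommClass.symm S Rᵐᵒᵖ T
  have hres := hasFiniteAddCoresolution_hom (S := S) (T := T) n hpd.1.hasProjectiveDimensionLE
    X f f0 hX hf0 h0 hf fun i => ModuleCat.exists_comp_eq_of_extVanish
      (Y := ModuleCat.of Rᵐᵒᵖ T) X f f0 (fun i => (hX i).projective) hf0 h0 hf i
      (hext (i + 1) i.succ_pos)
  exact hres.of_linearEquiv (LinearEquiv.ofBijective
    { toFun := Module.toModuleEnd Rᵐᵒᵖ T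
      map_add' := map_add _
      map_smul' := fun s t => by ext x; exact mul_smul s t x } hS)
end
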